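/- arXiv:2310.09295 — 2 statements merged into one kernel-verified Lean document; each statement's English description precedes it below -/
import Mathlib

section
/- Let r, λ, x*, α > 0 with 0 < λ/r < α. Define f : (0,∞) → ℝ by f(x) = 1 for 0 < x ≤ x*, and f(x) = (Γ(α)/(Γ(λ/r)·Γ(α − λ/r + 1)))·(x/x*)^{λ/r − α}·₂F₁(α − λ/r, 1 − λ/r; α − λ/r + 1; x*/x) for x > x*. Then: (i) f is differentiable on (x*,∞) and satisfies r(x − x*) f'(x) − λ f(x) + (λα/x^α)·∫₀^x f(u) u^{α−1} du = 0 for all x > x*; (ii) lim_{x→x*⁺} f(x) = 1; (iii) lim_{x→∞} f(x) = 0. -/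
open MeasureTheory

/-- The Gauss hypergeometric function `₂F₁(a,b;c;w)` as the sum of its series
`∑ (a)ₙ (b)ₙ / ((c)ₙ n!) wⁿ`, with `(q)ₙ` the rising factorial. -/
noncomputable def hyp2F1 (a b c w : ℝ) : ℝ :=
  ∑' n : ℕ,
    Polynomial.eval a (ascPochhammer ℝ n) * Polynomial.eval b (ascPochhammer ℝ n) /
      (Polynomial.eval c (ascPochhammer ℝ n) * (Nat.factorial n : ℝ)) * w ^ n

theorem hasSum_ascPochhammer_div_factorial_mul_pow (b : ℝ) {t : ℝ} (ht : |t| < 1) :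
    HasSum (fun n : ℕ => (ascPochhammer ℝ n).eval b / (n.factorial : ℝ) * t ^ n)
      ((1 - t) ^ (-b)) := by
  have h := (Real.one_div_one_sub_rpow_hasFPowerSeriesOnBall_zero b).hasSum (y := t)
    (by simpa [enorm_eq_nnnorm, ← NNReal.coe_lt_coe] using ht)
  have hpos : 0 < 1 - t := by linarith [(abs_lt.1 ht).2]
  rw [zero_add, one_div, ← Real.rpow_neg hpos.le] at h
  refine (congrArg (HasSum · _) (funext fun n => ?_)).mpr h
  rw [FormalMultilinearSeries.ofScalars_apply_eq, smul_eq_mul, ← Ring.multichoose_eq]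
  congr 1
  rw [div_eq_iff (by positivity), ← Polynomial.ascPochhammer_smeval_eq_eval,
    ← Ring.factorial_nsmul_multichoose_eq_ascPochhammer, nsmul_eq_mul, mul_comm]

theorem ascPochhammer_eval_div_eval_add_one {a : ℝ} (ha : 0 < a) (n : ℕ) :
    (ascPochhammer ℝ n).eval a / (ascPochhammer ℝ n).eval (a + 1) = a / (a + n) := by
  have h : (ascPochhammer ℝ n).eval a * (a + n) = a * (ascPochhammer ℝ n).eval (a + 1) := by
    rw [← ascPochhammer_succ_eval, ascPochhammer_succ_left]
    simp
  have h1 : 0 < (ascPochhammer ℝ n).eval (a + 1) := ascPochhammer_pos n _ (by positivity)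
  rw [div_eq_div_iff h1.ne' (by positivity), h]

/-- The Euler-type integral of `₂F₁(a, b; a + 1; w)` as an incomplete beta function. -/
theorem integral_rpow_mul_one_sub_rpow {a : ℝ} (b : ℝ) (ha : 0 < a) {w : ℝ} (hw : 0 < w)
    (hw1 : w < 1) :
    ∫ t in (0 : ℝ)..w, t ^ (a - 1) * (1 - t) ^ (-b) = w ^ a / a * hyp2F1 a b (a + 1) w := by
  set c : ℕ → ℝ := fun n => (ascPochhammer ℝ n).eval b / (n.factorial : ℝ) with hc
  have hsum : Summable fun n => |c n| * w ^ n := by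
    have := (hasSum_ascPochhammer_div_factorial_mul_pow b
      (abs_lt.2 ⟨by linarith, hw1⟩ : |w| < 1)).summable.abs
    simpa [hc, abs_mul, abs_div, abs_of_pos hw] using this
  have hint : IntervalIntegrable (fun t : ℝ => t ^ (a - 1)) volume 0 w :=
    intervalIntegral.intervalIntegrable_rpow' (by linarith)
  have key := intervalIntegral.hasSum_integral_of_dominated_convergence (μ := volume)
    (a := 0) (b := w) (F := fun n t => t ^ (a - 1) * (c n * t ^ n))
    (f := fun t => t ^ (a - 1) * (1 - t) ^ (-b))
    (fun n t => t ^ (a - 1) * (|c n| * w ^ n))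
    (fun n => Measurable.aestronglyMeasurable (by fun_prop))
    (fun n => Filter.Eventually.of_forall fun t ht => by
      rw [Set.uIoc_of_le hw.le] at ht
      have h0 := ht.1
      rw [norm_mul, norm_mul, norm_pow, Real.norm_of_nonneg (Real.rpow_nonneg h0.le _),
        Real.norm_of_nonneg h0.le, Real.norm_eq_abs]
      gcongr
      exact ht.2)
    (Filter.Eventually.of_forall fun t _ => hsum.mul_left _)
    (by simpa only [tsum_mul_left] using hint.mul_const _)
    (Filter.Eventually.of_forall fun t ht => by
      rw [Set.uIoc_of_le hw.le] at ht
      exact (hasSum_ascPochhammer_div_factorial_mul_pow b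
        (abs_lt.2 ⟨by linarith [ht.1], by linarith [ht.2]⟩)).mul_left _)
  rw [← key.tsum_eq, hyp2F1, ← tsum_mul_left]
  congr 1 with n
  have hterm : ∫ t in (0 : ℝ)..w, t ^ (a - 1) * (c n * t ^ n)
      = c n * (w ^ a * w ^ n / (a + n)) := by
    have hcongr : ∫ t in (0 : ℝ)..w, t ^ (a - 1) * (c n * t ^ n)
        = ∫ t in (0 : ℝ)..w, c n * t ^ (a + n - 1) := by
      refine intervalIntegral.integral_congr_ae (Filter.Eventually.of_forall fun t ht => ?_)
      rw [Set.uIoc_of_le hw.le] at ht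
      rw [add_sub_right_comm, Real.rpow_add_natCast ht.1.ne']
      ring
    have hn : (0 : ℝ) < a + n := by positivity
    rw [hcongr, intervalIntegral.integral_const_mul, integral_rpow (Or.inl (by linarith)),
      sub_add_cancel, Real.zero_rpow hn.ne', sub_zero, Real.rpow_add_natCast hw.ne']
  have hn : (0 : ℝ) < a + n := by positivity
  rw [hterm, mul_div_mul_comm, ascPochhammer_eval_div_eval_add_one ha]
  simp only [hc]
  field_simp

theorem intervalIntegrable_rpow_mul_one_sub_rpow {a s : ℝ} (ha : 0 < a) (hs : 0 < s) :
    IntervalIntegrable (fun t : ℝ => t ^ (a - 1) * (1 - t) ^ (s - 1)) volume 0 1 := by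
  have h := Complex.betaIntegral_convergent (u := a) (v := s) (by simpa) (by simpa)
  rw [intervalIntegrable_iff_integrableOn_Ioc_of_le zero_le_one] at h ⊢
  refine h.re.congr (ae_restrict_of_forall_mem measurableSet_Ioc fun x hx => ?_)
  have hx' : ((x : ℂ) ^ ((a : ℂ) - 1) * (1 - (x : ℂ)) ^ ((s : ℂ) - 1)) =
      ((x ^ (a - 1) * (1 - x) ^ (s - 1) : ℝ) : ℂ) := by
    push_cast [Complex.ofReal_cpow hx.1.le, Complex.ofReal_cpow (sub_nonneg.2 hx.2)]
    rfl
  simp only [hx', RCLike.re_to_complex, Complex.ofReal_re]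

theorem integral_rpow_mul_one_sub_rpow_zero_one {a s : ℝ} (ha : 0 < a) (hs : 0 < s) :
    ∫ t in (0 : ℝ)..1, t ^ (a - 1) * (1 - t) ^ (s - 1) =
      Real.Gamma a * Real.Gamma s / Real.Gamma (a + s) := by
  have h := ProbabilityTheory.beta_eq_betaIntegralReal a s ha hs
  rw [ProbabilityTheory.beta] at h
  have hC : Complex.betaIntegral a s =
      ((∫ t in (0 : ℝ)..1, t ^ (a - 1) * (1 - t) ^ (s - 1) : ℝ) : ℂ) := by
    rw [Complex.betaIntegral, ← intervalIntegral.integral_ofReal]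
    refine intervalIntegral.integral_congr fun x hx => ?_
    rw [Set.uIcc_of_le zero_le_one] at hx
    push_cast [Complex.ofReal_cpow hx.1, Complex.ofReal_cpow (sub_nonneg.2 hx.2)]
    rfl
  rw [h, hC, Complex.ofReal_re]

theorem hasDerivAt_integral_rpow_mul_one_sub_rpow {a s w : ℝ} (ha : 0 < a) (hs : 0 < s)
    (hw : 0 < w) (hw1 : w < 1) :
    HasDerivAt (fun v => ∫ t in (0 : ℝ)..v, t ^ (a - 1) * (1 - t) ^ (s - 1))
      (w ^ (a - 1) * (1 - w) ^ (s - 1)) w := by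
  refine intervalIntegral.integral_hasDerivAt_right
    ((intervalIntegrable_rpow_mul_one_sub_rpow ha hs).mono_set ?_)
    (Measurable.stronglyMeasurable (by fun_prop)).stronglyMeasurableAtFilter ?_
  · rw [Set.uIcc_of_le hw.le, Set.uIcc_of_le zero_le_one]
    exact Set.Icc_subset_Icc_right hw1.le
  · exact (Real.continuousAt_rpow_const _ _ (Or.inl hw.ne')).mul
      (ContinuousAt.rpow_const (by fun_prop) (Or.inl (by linarith)))

theorem continuousOn_integral_rpow_mul_one_sub_rpow {a s : ℝ} (ha : 0 < a) (hs : 0 < s) :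
    ContinuousOn (fun v => ∫ t in (0 : ℝ)..v, t ^ (a - 1) * (1 - t) ^ (s - 1))
      (Set.Icc 0 1) := by
  have h := intervalIntegral.continuousOn_primitive_interval'
    (intervalIntegrable_rpow_mul_one_sub_rpow ha hs) Set.left_mem_uIcc
  rwa [Set.uIcc_of_le zero_le_one] at h

theorem hasDerivAt_integral_rpow_mul_one_sub_rpow_div {a s c x : ℝ} (ha : 0 < a) (hs : 0 < s)
    (hc : 0 < c) (hx : c < x) :
    HasDerivAt (fun y => ∫ t in (0 : ℝ)..c / y, t ^ (a - 1) * (1 - t) ^ (s - 1))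
      (-(c ^ a * (x - c) ^ (s - 1) / x ^ (a + s))) x := by
  have hx0 : 0 < x := hc.trans hx
  have hd : HasDerivAt (fun y : ℝ => c / y) (c * (-(x ^ 2)⁻¹)) x := by
    simpa only [div_eq_mul_inv] using (hasDerivAt_inv hx0.ne').const_mul c
  have h := (hasDerivAt_integral_rpow_mul_one_sub_rpow ha hs (div_pos hc hx0)
    ((div_lt_one hx0).2 hx)).comp x hd
  refine h.congr_deriv ?_
  have h1 : (1 : ℝ) - c / x = (x - c) / x := by field_simp
  have h2 : c ^ a = c ^ (a - 1) * c := by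
    rw [← Real.rpow_add_one hc.ne', sub_add_cancel]
  have h3 : x ^ (a + s) = x ^ (a - 1) * x ^ (s - 1) * x ^ 2 := by
    rw [← Real.rpow_add hx0, ← Real.rpow_natCast x 2, ← Real.rpow_add hx0]
    congr 1
    push_cast
    ring
  have h4 : 0 < x ^ (a - 1) := Real.rpow_pos_of_pos hx0 _
  have h5 : 0 < x ^ (s - 1) := Real.rpow_pos_of_pos hx0 _
  rw [h1, Real.div_rpow hc.le hx0.le, Real.div_rpow (sub_pos.2 hx).le hx0.le, h2, h3]
  field_simp

/-- Integration by parts for a function equal to `1` on `(0, c]` whose derivative on `(c, ∞)` is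
`-(M * (u - c) ^ (s - 1) / u ^ α)`. -/
theorem setIntegral_Ioo_mul_rpow {s c α M x : ℝ} {f : ℝ → ℝ} (hs : 0 < s) (hc : 0 < c)
    (hα : 0 < α) (hx : c < x) (hf1 : ∀ u, 0 < u → u ≤ c → f u = 1)
    (hcont : ContinuousOn f (Set.Ici c))
    (hderiv : ∀ u, c < u → HasDerivAt f (-(M * (u - c) ^ (s - 1) / u ^ α)) u) :
    ∫ u in Set.Ioo 0 x, f u * u ^ (α - 1) =
      f x * x ^ α / α + M * (x - c) ^ s / (s * α) := by
  have hEq : Set.EqOn (fun u => f u * u ^ (α - 1)) (fun u => u ^ (α - 1)) (Set.uIoc 0 c) := by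
    intro u hu
    rw [Set.uIoc_of_le hc.le] at hu
    simp [hf1 u hu.1 hu.2]
  have hint1 : IntervalIntegrable (fun u => f u * u ^ (α - 1)) volume 0 c :=
    (intervalIntegral.intervalIntegrable_rpow' (by linarith)).congr hEq.symm
  have hI1 : ∫ u in (0 : ℝ)..c, f u * u ^ (α - 1) = c ^ α / α := by
    rw [intervalIntegral.integral_congr_ae (Filter.Eventually.of_forall hEq), integral_rpow (Or.inl (by linarith)),
      sub_add_cancel, Real.zero_rpow hα.ne', sub_zero]
  have hcont' : ContinuousOn f (Set.Icc c x) := hcont.mono Set.Icc_subset_Ici_self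
  have hpow (p : ℝ) : ContinuousOn (fun u : ℝ => u ^ p) (Set.Icc c x) := fun u hu =>
    (Real.continuousAt_rpow_const _ _ (Or.inl (hc.trans_le hu.1).ne')).continuousWithinAt
  have hint2 : IntervalIntegrable (fun u => f u * u ^ (α - 1)) volume c x :=
    ContinuousOn.intervalIntegrable_of_Icc hx.le (hcont'.mul (hpow _))
  have hI2 := intervalIntegral.integral_eq_sub_of_hasDerivAt_of_le hx.le
    (f := fun u => f u * u ^ α / α + M * (u - c) ^ s / (s * α))
    (f' := fun u => f u * u ^ (α - 1))
    (((hcont'.mul (hpow _)).div_const _).add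
      ((continuousOn_const.mul (ContinuousOn.rpow_const (by fun_prop)
        fun _ _ => Or.inr hs.le)).div_const _))
    (fun u hu => by
      have hu0 : 0 < u := hc.trans hu.1
      have h1 := ((hderiv u hu.1).mul
        (Real.hasDerivAt_rpow_const (p := α) (Or.inl hu0.ne'))).div_const α
      have h2 := ((((hasDerivAt_id u).sub_const c).rpow_const (p := s)
        (Or.inl (sub_pos.2 hu.1).ne')).const_mul M).div_const (s * α)
      refine (h1.add h2).congr_deriv ?_
      have h3 : 0 < u ^ α := Real.rpow_pos_of_pos hu0 _
      simp only [id]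
      field_simp
      ring)
    hint2
  rw [← integral_Ioc_eq_integral_Ioo, ← intervalIntegral.integral_of_le (hc.trans hx).le,
    ← intervalIntegral.integral_add_adjacent_intervals hint1 hint2, hI1, hI2,
    hf1 c hc le_rfl, sub_self, Real.zero_rpow hs.ne']
  ring

/-- Proposition 3.3: for `0 < λ/r < α`, the function equal to `1` on `(0, x*]` and to
`(Γ(α)/(Γ(λ/r)Γ(α−λ/r+1)))(x/x*)^(λ/r−α) ₂F₁(α−λ/r, 1−λ/r; α−λ/r+1; x*/x)` on `(x*,∞)`
is differentiable on `(x*,∞)`, satisfies the infinitesimal generator equation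
`r(x−x*)f'(x) − λ f(x) + (λα/x^α)∫₀^x f(u)u^(α−1) du = 0` there, tends to `1` as
`x → x*⁺` and tends to `0` as `x → ∞`. -/
theorem stmt6 (r lam xstar α : ℝ) (hr : 0 < r) (hlam : 0 < lam) (hxstar : 0 < xstar)
    (hα : 0 < α) (hcond : lam / r < α) (f : ℝ → ℝ)
    (hf1 : ∀ x : ℝ, 0 < x → x ≤ xstar → f x = 1)
    (hf2 : ∀ x : ℝ, xstar < x → f x =
      Real.Gamma α / (Real.Gamma (lam / r) * Real.Gamma (α - lam / r + 1)) *
        (x / xstar) ^ (lam / r - α) *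
        hyp2F1 (α - lam / r) (1 - lam / r) (α - lam / r + 1) (xstar / x)) :
    (∀ x : ℝ, xstar < x → DifferentiableAt ℝ f x ∧
        r * (x - xstar) * deriv f x - lam * f x +
          (lam * α / x ^ α) * ∫ u in Set.Ioo (0:ℝ) x, f u * u ^ (α - 1) = 0) ∧
    Filter.Tendsto f (nhdsWithin xstar (Set.Ioi xstar)) (nhds 1) ∧
    Filter.Tendsto f Filter.atTop (nhds 0) := by
  set s := lam / r with hs_def
  have hs : 0 < s := div_pos hlam hr
  obtain ⟨a, ha_def⟩ : ∃ a, a = α - s := ⟨_, rfl⟩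
  have ha : 0 < a := by linarith
  have has : a + s = α := by linarith
  set B : ℝ → ℝ := fun v => ∫ t in (0 : ℝ)..v, t ^ (a - 1) * (1 - t) ^ (s - 1) with hB
  set K : ℝ := Real.Gamma α / (Real.Gamma s * Real.Gamma a)
  have hΓs := Real.Gamma_pos_of_pos hs
  have hΓa := Real.Gamma_pos_of_pos ha
  have hΓα := Real.Gamma_pos_of_pos hα
  have hfB : ∀ x, xstar < x → f x = K * B (xstar / x) := by
    intro x hx
    have hx0 : 0 < x := hxstar.trans hx
    have hB' := integral_rpow_mul_one_sub_rpow (1 - s) ha (div_pos hxstar hx0)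
      ((div_lt_one hx0).2 hx)
    rw [neg_sub] at hB'
    have hpow : (x / xstar) ^ (s - α) = (xstar / x) ^ a := by
      rw [← inv_div, Real.inv_rpow (div_pos hxstar hx0).le,
        ← Real.rpow_neg (div_pos hxstar hx0).le, ha_def, neg_sub]
    rw [hf2 x hx, hpow, ← ha_def, Real.Gamma_add_one ha.ne']
    simp only [hB, hB', K]
    field_simp
  have hB1 : K * B 1 = 1 := by
    simp only [hB, K, integral_rpow_mul_one_sub_rpow_zero_one ha hs, has]
    field_simp
  have hBcont : ContinuousOn B (Set.Icc 0 1) :=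
    continuousOn_integral_rpow_mul_one_sub_rpow ha hs
  have hcont : ContinuousOn f (Set.Ici xstar) := by
    have h : ContinuousOn (fun x => K * B (xstar / x)) (Set.Ici xstar) := by
      refine continuousOn_const.mul (hBcont.comp (continuousOn_const.div continuousOn_id
        fun x hx => (hxstar.trans_le hx).ne') fun x hx => ?_)
      have hx0 : 0 < x := hxstar.trans_le hx
      exact ⟨(div_pos hxstar hx0).le, (div_le_one hx0).2 hx⟩
    refine h.congr fun x hx => ?_
    rcases eq_or_lt_of_le (Set.mem_Ici.1 hx) with rfl | hlt
    · simp only [hf1 _ hxstar le_rfl, div_self hxstar.ne', hB1]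
    · exact hfB x hlt
  have hderiv : ∀ x, xstar < x →
      HasDerivAt f (-(K * xstar ^ a * (x - xstar) ^ (s - 1) / x ^ α)) x := by
    intro x hx
    have h := (hasDerivAt_integral_rpow_mul_one_sub_rpow_div ha hs hxstar hx).const_mul K
    rw [has] at h
    refine (h.congr_of_eventuallyEq ?_).congr_deriv (by ring)
    filter_upwards [lt_mem_nhds hx] with y hy using hfB y hy
  refine ⟨fun x hx => ⟨(hderiv x hx).differentiableAt, ?_⟩, ?_, ?_⟩
  · rw [(hderiv x hx).deriv, setIntegral_Ioo_mul_rpow hs hxstar hα hx hf1 hcont hderiv]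
    have hlam_eq : lam = s * r := by rw [hs_def, div_mul_cancel₀ _ hr.ne']
    have hxα : 0 < x ^ α := Real.rpow_pos_of_pos (hxstar.trans hx) _
    have hsub : (x - xstar) ^ s = (x - xstar) ^ (s - 1) * (x - xstar) := by
      rw [← Real.rpow_add_one (sub_pos.2 hx).ne', sub_add_cancel]
    rw [hsub, hlam_eq]
    field_simp
    ring
  · have h := (hcont xstar Set.self_mem_Ici).mono Set.Ioi_subset_Ici_self
    rwa [ContinuousWithinAt, hf1 _ hxstar le_rfl] at h
  · have h0 : B 0 = 0 := intervalIntegral.integral_same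
    have hdiv : Filter.Tendsto (fun x => xstar / x) Filter.atTop
        (nhdsWithin 0 (Set.Icc 0 1)) := by
      refine tendsto_nhdsWithin_iff.2 ⟨Filter.Tendsto.const_div_atTop Filter.tendsto_id _, ?_⟩
      filter_upwards [Filter.eventually_ge_atTop xstar] with x hx
      have hx0 : 0 < x := hxstar.trans_le hx
      exact ⟨(div_pos hxstar hx0).le, (div_le_one hx0).2 hx⟩
    have h := ((hBcont 0 (by simp)).tendsto.comp hdiv).const_mul K
    rw [h0, mul_zero] at h
    refine h.congr' ?_
    filter_upwards [Filter.eventually_gt_atTop xstar] with x hx using (hfB x hx).symm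
end

section
/- Let x* > 0, κ ∈ (0,1) and λ, r > 0 with 0 < λ/r < 1. Let a₁ ∈ ℂ be given by a₁ = (1/2)(1 − λ/r) + (1/2)·√((1 + λ/r)² − 4λ/(rκ)), where the square root is the principal complex square root, and for t > 0 and c ∈ ℂ set t^c := exp(c·log t). Define u, v : (0,∞) → ℂ by u(x̃) = (1 + x̃/x*)^{−a₁}·₂F₁(a₁, a₁; 1 − λ/r; x̃/(x̃ + x*)) and v(x̃) = (x̃/(x̃ + x*))^{λ/r}·(1 + x̃/x*)^{−a₁}·₂F₁(λ/r + a₁, λ/r + a₁; 1 + λ/r; x̃/(x̃ + x*)). Then both u and v are twice differentiable on (0,∞) and satisfy x̃(x̃ + x*)·y''(x̃) + ((2 − λ/r)·x̃ + x*(1 − λ/r))·y'(x̃) + (λ(1 − κ)/(rκ))·y(x̃) = 0 for all x̃ > 0. -/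
/-- The Gauss hypergeometric function `₂F₁(a,b;c;w)` with complex parameters, as the sum
of its series `∑ (a)ₙ (b)ₙ / ((c)ₙ n!) wⁿ`, with `(q)ₙ` the rising factorial. -/
noncomputable def hyp2F1C (a b c w : ℂ) : ℂ :=
  ∑' n : ℕ,
    Polynomial.eval a (ascPochhammer ℂ n) * Polynomial.eval b (ascPochhammer ℂ n) /
      (Polynomial.eval c (ascPochhammer ℂ n) * (Nat.factorial n : ℂ)) * w ^ n

/-- A power series converging on the open unit disc can be differentiated termwise there. -/
lemma summable_and_hasDerivAt_tsum_mul_pow {t : ℕ → ℂ}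
    (ht : ∀ w : ℂ, ‖w‖ < 1 → Summable fun n => t n * w ^ n) {w : ℂ} (hw : ‖w‖ < 1) :
    (Summable fun n : ℕ => ((n : ℂ) + 1) * t (n + 1) * w ^ n) ∧
      HasDerivAt (fun z => ∑' n, t n * z ^ n) (∑' n : ℕ, ((n : ℂ) + 1) * t (n + 1) * w ^ n) w := by
  let p : FormalMultilinearSeries ℂ ℂ ℂ := .ofScalars ℂ t
  have hp : ∀ n z, p n (fun _ => z) = t n * z ^ n := fun n z => by
    simp [p, mul_comm]
  have hr : 1 ≤ p.radius := by
    refine ENNReal.le_of_forall_nnreal_lt fun ρ hρ => ?_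
    have hρ1 : ‖((ρ : ℝ) : ℂ)‖ < 1 := by
      simpa using hρ
    refine p.le_radius_of_tendsto (l := 0) ?_
    simpa [p, FormalMultilinearSeries.ofScalars_norm] using
      (ht _ hρ1).tendsto_atTop_zero.norm
  have hsum : p.sum = fun z => ∑' n, t n * z ^ n := by
    funext z
    simp [FormalMultilinearSeries.sum, hp]
  have hball : HasFPowerSeriesOnBall (fun z => ∑' n, t n * z ^ n) p 0 1 :=
    hsum ▸ (p.hasFPowerSeriesOnBall (one_pos.trans_le hr)).mono one_pos hr
  have hmem : w ∈ Metric.eball (0 : ℂ) 1 := by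
    rwa [Metric.mem_eball, edist_zero_right, ← ofReal_norm, ENNReal.ofReal_lt_one]
  have hd : HasSum (fun n : ℕ => ((n : ℂ) + 1) * t (n + 1) * w ^ n)
      (deriv (fun z => ∑' n, t n * z ^ n) w) := by
    have h := (hball.fderiv.hasSum hmem).mapL (ContinuousLinearMap.apply ℂ ℂ (1 : ℂ))
    convert! h using 1
    · funext n
      simp [p, FormalMultilinearSeries.coeff_ofScalars, mul_comm]
    · simp
  refine ⟨hd.summable, ?_⟩
  rw [hd.tsum_eq]
  exact (hball.differentiableOn.differentiableAt (Metric.isOpen_eball.mem_nhds hmem)).hasDerivAt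

lemma summable_hyp2F1C (a b c : ℂ) {w : ℂ} (hw : ‖w‖ < 1) :
    Summable fun n : ℕ =>
      Polynomial.eval a (ascPochhammer ℂ n) * Polynomial.eval b (ascPochhammer ℂ n) /
        (Polynomial.eval c (ascPochhammer ℂ n) * (Nat.factorial n : ℂ)) * w ^ n := by
  have hr : 1 ≤ (ordinaryHypergeometricSeries ℂ a b c).radius := by
    by_cases h : ∀ k : ℕ, (k : ℂ) ≠ -a ∧ (k : ℂ) ≠ -b ∧ (k : ℂ) ≠ -c
    · exact (ordinaryHypergeometricSeries_radius_eq_one ℂ a b c h).ge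
    · obtain ⟨k, hk⟩ : ∃ k : ℕ, (k : ℂ) = -a ∨ (k : ℂ) = -b ∨ (k : ℂ) = -c := by
        by_contra! h'
        exact h h'
      have htop : (ordinaryHypergeometricSeries ℂ a b c).radius = ⊤ :=
        FormalMultilinearSeries.radius_eq_top_of_forall_image_add_eq_zero _ (1 + k) fun n =>
          ordinaryHypergeometricSeries_eq_zero_of_neg_nat a b c hk (by lia)
      simp [htop]
  have hmem : w ∈ Metric.eball (0 : ℂ) (ordinaryHypergeometricSeries ℂ a b c).radius :=
    Metric.eball_subset_eball hr 
      (by rwa [Metric.mem_eball, edist_zero_right, ← ofReal_norm, ENNReal.ofReal_lt_one])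
  refine ((ordinaryHypergeometricSeries ℂ a b c).summable hmem).congr fun n => ?_
  rw [ordinaryHypergeometricSeries_apply_eq, smul_eq_mul]
  simp only [div_eq_mul_inv, mul_inv]
  ring

/-- Gauss's hypergeometric differential equation on the open unit disc. -/
lemma exists_hasDerivAt_hyp2F1C (a b c : ℂ) (hc : ∀ k : ℕ, c + k ≠ 0) :
    ∃ F₁ F₂ : ℂ → ℂ, ∀ w : ℂ, ‖w‖ < 1 →
      HasDerivAt (hyp2F1C a b c) (F₁ w) w ∧ HasDerivAt F₁ (F₂ w) w ∧
        w * (1 - w) * F₂ w + (c - (a + b + 1) * w) * F₁ w - a * b * hyp2F1C a b c w = 0 := by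
  set t : ℕ → ℂ := fun n =>
    Polynomial.eval a (ascPochhammer ℂ n) * Polynomial.eval b (ascPochhammer ℂ n) /
      (Polynomial.eval c (ascPochhammer ℂ n) * (Nat.factorial n : ℂ)) with ht
  have hrec : ∀ n : ℕ, ((n : ℂ) + 1) * (c + n) * t (n + 1) = (a + n) * (b + n) * t n := fun n => by
    have h1 : (n : ℂ) + 1 ≠ 0 := Nat.cast_add_one_ne_zero n
    have h2 : Polynomial.eval c (ascPochhammer ℂ n) ≠ 0 := by
      rw [Ne, ascPochhammer_eval_eq_zero_iff]
      rintro ⟨k, -, hk⟩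
      exact hc k (by rw [hk]; ring)
    have h3 : (Nat.factorial n : ℂ) ≠ 0 := Nat.cast_ne_zero.2 n.factorial_ne_zero
    have h4 := hc n
    simp only [ht, ascPochhammer_succ_eval, Nat.factorial_succ, Nat.cast_mul, Nat.cast_succ]
    field_simp
  have h0 : ∀ w : ℂ, ‖w‖ < 1 → Summable fun n => t n * w ^ n := fun w hw =>
    summable_hyp2F1C a b c hw
  set t₁ : ℕ → ℂ := fun n => ((n : ℂ) + 1) * t (n + 1) with ht₁
  set t₂ : ℕ → ℂ := fun n => ((n : ℂ) + 1) * t₁ (n + 1) with ht₂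
  have h1 : ∀ w : ℂ, ‖w‖ < 1 → Summable fun n => t₁ n * w ^ n := fun w hw =>
    (summable_and_hasDerivAt_tsum_mul_pow h0 hw).1
  refine ⟨fun w => ∑' n, t₁ n * w ^ n, fun w => ∑' n, t₂ n * w ^ n, fun w hw =>
    ⟨(summable_and_hasDerivAt_tsum_mul_pow h0 hw).2,
      (summable_and_hasDerivAt_tsum_mul_pow h1 hw).2, ?_⟩⟩
  have s0 : HasSum (fun n => t n * w ^ n) (hyp2F1C a b c w) := (h0 w hw).hasSum
  have s1 := (h1 w hw).hasSum
  have s2 : HasSum (fun n => t₂ n * w ^ n) (∑' n, t₂ n * w ^ n) :=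
    (summable_and_hasDerivAt_tsum_mul_pow h1 hw).1.hasSum
  have s1' : HasSum (fun n : ℕ => (n : ℂ) * t n * w ^ n) (w * ∑' n, t₁ n * w ^ n) := by
    rw [← hasSum_nat_add_iff' 1]
    simpa [ht₁, pow_succ, mul_comm, mul_left_comm, mul_assoc] using s1.mul_left w
  have s2' : HasSum (fun n : ℕ => (n : ℂ) * t₁ n * w ^ n) (w * ∑' n, t₂ n * w ^ n) := by
    rw [← hasSum_nat_add_iff' 1]
    simpa [ht₂, pow_succ, mul_comm, mul_left_comm, mul_assoc] using s2.mul_left w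
  have s2'' : HasSum (fun n : ℕ => (n : ℂ) * ((n : ℂ) - 1) * t n * w ^ n)
      (w * (w * ∑' n, t₂ n * w ^ n)) := by
    rw [← hasSum_nat_add_iff' 1]
    simpa [ht₁, pow_succ, mul_comm, mul_left_comm, mul_assoc] using s2'.mul_left w
  have key := (((s2'.sub s2'').add (s1.mul_left c)).sub (s1'.mul_left (a + b + 1))).sub
    (s0.mul_left (a * b))
  have hz : ∀ n : ℕ, (n : ℂ) * t₁ n * w ^ n - (n : ℂ) * ((n : ℂ) - 1) * t n * w ^ n +
      c * (t₁ n * w ^ n) - (a + b + 1) * ((n : ℂ) * t n * w ^ n) - a * b * (t n * w ^ n) = 0 :=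
    fun n => by
      simp only [ht₁]
      linear_combination w ^ n * hrec n
  simp only [hz] at key
  linear_combination key.unique hasSum_zero

/-- A multiplier `E` behaving like `x ^ α * (x + s) ^ (-β)`, times `₂F₁(β, β; c; x / (x + s))`,
solves the transformed hypergeometric equation. -/
lemma exists_hasDerivAt_mul_hyp2F1C {s : ℝ} (hs : 0 < s) {E : ℝ → ℂ} {α β c μ : ℂ}
    (hc : ∀ k : ℕ, c + k ≠ 0) (hcα : c = 1 - μ + 2 * α) (hα : α * (α - μ) = 0)
    (hE : ∀ x > (0:ℝ), HasDerivAt E (E x * (α / x - β / (x + s))) x) :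
    ∃ D₁ D₂ : ℝ → ℂ, ∀ x > (0:ℝ),
      HasDerivAt (fun x : ℝ => E x * hyp2F1C β β c ((x / (x + s) : ℝ) : ℂ)) (D₁ x) x ∧
      HasDerivAt D₁ (D₂ x) x ∧
      (x * (x + s) : ℂ) * D₂ x + ((2 - μ) * x + s * (1 - μ)) * D₁ x +
        (β - α) * (1 - μ - (β - α)) *
          (E x * hyp2F1C β β c ((x / (x + s) : ℝ) : ℂ)) = 0 := by
  obtain ⟨F₁, F₂, hF⟩ := exists_hasDerivAt_hyp2F1C β β c hc
  have hw : ∀ x > (0:ℝ), ‖((x / (x + s) : ℝ) : ℂ)‖ < 1 := fun x hx => by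
    rw [Complex.norm_real, Real.norm_of_nonneg (by positivity), div_lt_one (by positivity)]
    linarith
  have hdw : ∀ x > (0:ℝ), HasDerivAt (fun x : ℝ => ((x / (x + s) : ℝ) : ℂ))
      ((s : ℂ) / (x + s) ^ 2) x := fun x hx => by
    have h := ((hasDerivAt_id x).div ((hasDerivAt_id x).add_const s)
      (by simp only [id]; positivity)).ofReal_comp
    convert! h using 1
    simp
  have hid : ∀ x : ℝ, HasDerivAt (fun y : ℝ => (y : ℂ)) 1 x := fun x =>
    (hasDerivAt_id x).ofReal_comp.congr_deriv (by simp)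
  refine ⟨fun x => E x * ((α / x - β / (x + s)) * hyp2F1C β β c ((x / (x + s) : ℝ) : ℂ) +
      s / (x + s) ^ 2 * F₁ ((x / (x + s) : ℝ) : ℂ)),
    fun x => E x * ((α / x - β / (x + s)) *
      ((α / x - β / (x + s)) * hyp2F1C β β c ((x / (x + s) : ℝ) : ℂ) +
        s / (x + s) ^ 2 * F₁ ((x / (x + s) : ℝ) : ℂ)) +
      (-α / x ^ 2 + β / (x + s) ^ 2) * hyp2F1C β β c ((x / (x + s) : ℝ) : ℂ) +
      (α / x - β / (x + s)) * (s / (x + s) ^ 2) * F₁ ((x / (x + s) : ℝ) : ℂ) -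
      2 * s / (x + s) ^ 3 * F₁ ((x / (x + s) : ℝ) : ℂ) +
      (s / (x + s) ^ 2) ^ 2 * F₂ ((x / (x + s) : ℝ) : ℂ)), fun x hx => ?_⟩
  obtain ⟨h1, h2, hode⟩ := hF _ (hw x hx)
  have hx0 : (x : ℂ) ≠ 0 := Complex.ofReal_ne_zero.2 hx.ne'
  have hxs : (x : ℂ) + s ≠ 0 := by exact_mod_cast (add_pos hx hs).ne'
  have hF0 := h1.comp x (hdw x hx)
  have hF1 := h2.comp x (hdw x hx)
  have hq : HasDerivAt (fun y : ℝ => α / (y : ℂ) - β / ((y : ℂ) + s))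
      (-α / (x : ℂ) ^ 2 + β / ((x : ℂ) + s) ^ 2) x := by
    refine (((hasDerivAt_const x α).div (hid x) hx0).sub
      ((hasDerivAt_const x β).div ((hid x).add_const (s : ℂ)) hxs)).congr_deriv ?_
    field_simp
    ring
  have hg : HasDerivAt (fun y : ℝ => (s : ℂ) / ((y : ℂ) + s) ^ 2)
      (-2 * s / ((x : ℂ) + s) ^ 3) x := by
    refine ((hasDerivAt_const x (s : ℂ)).div (((hid x).add_const (s : ℂ)).pow 2)
      (pow_ne_zero 2 hxs)).congr_deriv ?_
    simp only [Pi.pow_apply]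
    field_simp
    ring
  refine ⟨((hE x hx).mul hF0).congr_deriv ?_,
    ((hE x hx).mul ((hq.mul hF0).add (hg.mul hF1))).congr_deriv ?_, ?_⟩
  · simp only [Function.comp]
    ring
  · simp only [Function.comp, Pi.mul_apply, Pi.add_apply]
    ring
  · beta_reduce
    have hwx : ((x / (x + s) : ℝ) : ℂ) = (x : ℂ) / (x + s) := by push_cast; ring
    generalize hyp2F1C β β c ((x / (x + s) : ℝ) : ℂ) = f at *
    generalize F₁ ((x / (x + s) : ℝ) : ℂ) = f₁ at *
    generalize F₂ ((x / (x + s) : ℝ) : ℂ) = f₂ at *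
    rw [hwx, hcα] at hode
    have hode' : (x : ℂ) * s * f₂ + ((1 - μ + 2 * α) * (x + s) - (2 * β + 1) * x) * (x + s) * f₁
        - β ^ 2 * (x + s) ^ 2 * f = 0 := by
      field_simp at hode
      linear_combination hode
    generalize E x = e
    have key : ((x : ℂ) * (x + s)) * (e * ((α / x - β / (x + s)) *
          ((α / x - β / (x + s)) * f + s / (x + s) ^ 2 * f₁) +
          (-α / x ^ 2 + β / (x + s) ^ 2) * f +
          (α / x - β / (x + s)) * (s / (x + s) ^ 2) * f₁ - 2 * s / (x + s) ^ 3 * f₁ +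
          (s / (x + s) ^ 2) ^ 2 * f₂)) +
        ((2 - μ) * x + s * (1 - μ)) *
          (e * ((α / x - β / (x + s)) * f + s / (x + s) ^ 2 * f₁)) +
        (β - α) * (1 - μ - (β - α)) * (e * f) =
        e * s / (x + s) ^ 3 * ((x : ℂ) * s * f₂ +
          ((1 - μ + 2 * α) * (x + s) - (2 * β + 1) * x) * (x + s) * f₁ -
            β ^ 2 * (x + s) ^ 2 * f) + s / x * e * f * (α * (α - μ)) := by
      field_simp
      ring
    rw [key, hode', hα]
    ring

/-- The logarithmic derivative of a complex power of a positive real function. -/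
lemma hasDerivAt_ofReal_cpow_of_pos {f : ℝ → ℝ} {f' x : ℝ} (hf : HasDerivAt f f' x)
    (hx : 0 < f x) (c : ℂ) :
    HasDerivAt (fun y => (f y : ℂ) ^ c) ((f x : ℂ) ^ c * (c * f' / f x)) x := by
  have hne : (f x : ℂ) ≠ 0 := Complex.ofReal_ne_zero.2 hx.ne'
  have h := (Complex.hasStrictDerivAt_cpow_const (c := c)
    (Complex.ofReal_mem_slitPlane.2 hx)).hasDerivAt.comp x hf.ofReal_comp
  refine h.congr_deriv ?_
  rw [Complex.cpow_sub _ _ hne, Complex.cpow_one]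
  field_simp

/-- Classical derivatives on `(0, ∞)` determine the iterated `deriv` there. -/
lemma differentiableAt_and_deriv_of_hasDerivAt_Ioi {u g D₁ D₂ : ℝ → ℂ} (hu : ∀ x > (0:ℝ), u x = g x)
    (h₁ : ∀ x > (0:ℝ), HasDerivAt g (D₁ x) x) (h₂ : ∀ x > (0:ℝ), HasDerivAt D₁ (D₂ x) x)
    {x : ℝ} (hx : 0 < x) :
    DifferentiableAt ℝ u x ∧ DifferentiableAt ℝ (deriv u) x ∧
      deriv u x = D₁ x ∧ deriv (deriv u) x = D₂ x := by
  have h₁' : ∀ y > (0:ℝ), HasDerivAt u (D₁ y) y := fun y hy =>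
    (h₁ y hy).congr_of_eventuallyEq ((lt_mem_nhds hy).mono hu)
  have h₂' : HasDerivAt (deriv u) (D₂ x) x :=
    (h₂ x hx).congr_of_eventuallyEq ((lt_mem_nhds hx).mono fun y hy => (h₁' y hy).deriv)
  exact ⟨(h₁' x hx).differentiableAt, h₂'.differentiableAt, (h₁' x hx).deriv, h₂'.deriv⟩

/-- The functions `u(x̃) = (1+x̃/x*)^(−a₁) ₂F₁(a₁,a₁;1−λ/r;x̃/(x̃+x*))` and
`v(x̃) = (x̃/(x̃+x*))^(λ/r) (1+x̃/x*)^(−a₁) ₂F₁(λ/r+a₁,λ/r+a₁;1+λ/r;x̃/(x̃+x*))`, with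
`a₁ = (1/2)(1−λ/r) + (1/2)√((1+λ/r)² − 4λ/(rκ))` (principal complex square root and
principal powers `t^c = exp(c log t)` for `t > 0`), are twice differentiable on `(0,∞)`
and solve `x̃(x̃+x*)y'' + ((2−λ/r)x̃ + x*(1−λ/r))y' + (λ(1−κ)/(rκ))y = 0` there. -/
theorem stmt16 (xstar κ lam r : ℝ) (hxstar : 0 < xstar) (hκ : κ ∈ Set.Ioo (0:ℝ) 1)
    (hlam : 0 < lam) (hr : 0 < r) (hlr : lam / r < 1) (a1 : ℂ)
    (ha1 : a1 = (1 / 2) * (1 - (lam / r : ℝ)) +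
      (1 / 2) * (((1 + lam / r) ^ 2 - 4 * lam / (r * κ) : ℝ) : ℂ) ^ ((1:ℂ) / 2))
    (u v : ℝ → ℂ)
    (hu : ∀ x > (0:ℝ), u x =
      ((1 + x / xstar : ℝ) : ℂ) ^ (-a1) *
        hyp2F1C a1 a1 (1 - (lam / r : ℝ)) ((x / (x + xstar) : ℝ) : ℂ))
    (hv : ∀ x > (0:ℝ), v x =
      ((x / (x + xstar) : ℝ) : ℂ) ^ ((lam / r : ℝ) : ℂ) *
        ((1 + x / xstar : ℝ) : ℂ) ^ (-a1) *
        hyp2F1C ((lam / r : ℝ) + a1) ((lam / r : ℝ) + a1) (1 + (lam / r : ℝ))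
          ((x / (x + xstar) : ℝ) : ℂ)) :
    (∀ x > (0:ℝ), DifferentiableAt ℝ u x ∧ DifferentiableAt ℝ (deriv u) x ∧
        ((x * (x + xstar) : ℝ) : ℂ) * deriv (deriv u) x +
            (((2 - lam / r) * x + xstar * (1 - lam / r) : ℝ) : ℂ) * deriv u x +
            ((lam * (1 - κ) / (r * κ) : ℝ) : ℂ) * u x = 0) ∧
    (∀ x > (0:ℝ), DifferentiableAt ℝ v x ∧ DifferentiableAt ℝ (deriv v) x ∧
        ((x * (x + xstar) : ℝ) : ℂ) * deriv (deriv v) x +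
            (((2 - lam / r) * x + xstar * (1 - lam / r) : ℝ) : ℂ) * deriv v x +
            ((lam * (1 - κ) / (r * κ) : ℝ) : ℂ) * v x = 0) := by
  have hμ0 : 0 < lam / r := div_pos hlam hr
  have hK : a1 * (1 - (lam / r : ℝ) - a1) = ((lam * (1 - κ) / (r * κ) : ℝ) : ℂ) := by
    set d : ℂ := (((1 + lam / r) ^ 2 - 4 * lam / (r * κ) : ℝ) : ℂ) ^ ((1:ℂ) / 2) with hd
    have hd2 : d ^ 2 = (((1 + lam / r) ^ 2 - 4 * lam / (r * κ) : ℝ) : ℂ) := by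
      rw [hd, one_div]
      exact_mod_cast Complex.cpow_nat_inv_pow _ two_ne_zero
    have hr0 : (r : ℂ) ≠ 0 := Complex.ofReal_ne_zero.2 hr.ne'
    have hκ0 : (κ : ℂ) ≠ 0 := Complex.ofReal_ne_zero.2 hκ.1.ne'
    have h : a1 * (1 - (lam / r : ℝ) - a1) = ((1 - (lam / r : ℝ)) ^ 2 - d ^ 2) / 4 := by
      rw [ha1]
      ring
    rw [h, hd2]
    push_cast
    field_simp
    ring
  have hP : ∀ x > (0:ℝ), HasDerivAt (fun y : ℝ => ((1 + y / xstar : ℝ) : ℂ) ^ (-a1))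
      (((1 + x / xstar : ℝ) : ℂ) ^ (-a1) * (-a1 / (x + xstar))) x := fun x hx => by
    have hs0 : (xstar : ℂ) ≠ 0 := Complex.ofReal_ne_zero.2 hxstar.ne'
    have hxs : (x : ℂ) + xstar ≠ 0 := by exact_mod_cast (add_pos hx hxstar).ne'
    have hxs' : (xstar : ℂ) + x ≠ 0 := by rwa [add_comm]
    refine (hasDerivAt_ofReal_cpow_of_pos (((hasDerivAt_id x).div_const xstar).const_add 1)
      (by simp only [id]; positivity) (-a1)).congr_deriv ?_
    simp only [id]
    congr 1
    push_cast
    field_simp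
    ring
  have hW : ∀ x > (0:ℝ), HasDerivAt
      (fun y : ℝ => ((y / (y + xstar) : ℝ) : ℂ) ^ ((lam / r : ℝ) : ℂ))
      (((x / (x + xstar) : ℝ) : ℂ) ^ ((lam / r : ℝ) : ℂ) *
        ((lam / r : ℝ) / x - (lam / r : ℝ) / (x + xstar))) x := fun x hx => by
    have hx0 : (x : ℂ) ≠ 0 := Complex.ofReal_ne_zero.2 hx.ne'
    have hxs : (x : ℂ) + xstar ≠ 0 := by exact_mod_cast (add_pos hx hxstar).ne'
    refine (hasDerivAt_ofReal_cpow_of_pos ((hasDerivAt_id x).div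
      ((hasDerivAt_id x).add_const xstar) (by simp only [id]; positivity))
      (by simp only [id, Pi.div_apply]; positivity) _).congr_deriv ?_
    simp only [id, Pi.div_apply]
    congr 1
    generalize lam / r = m
    push_cast
    field_simp
  have hc1 : ∀ k : ℕ, (1 - (lam / r : ℝ) : ℂ) + k ≠ 0 := fun k => by
    have : (1 - lam / r) + (k : ℝ) ≠ 0 :=
      (add_pos_of_pos_of_nonneg (sub_pos.2 hlr) k.cast_nonneg).ne'
    exact_mod_cast this
  have hc2 : ∀ k : ℕ, (1 + (lam / r : ℝ) : ℂ) + k ≠ 0 := fun k => by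
    have : (1 + lam / r) + (k : ℝ) ≠ 0 := by positivity
    exact_mod_cast this
  constructor
  · obtain ⟨D₁, D₂, h⟩ := exists_hasDerivAt_mul_hyp2F1C hxstar (α := 0) (β := a1)
      (μ := (lam / r : ℝ)) hc1 (by ring) (by ring)
      (fun x hx => (hP x hx).congr_deriv (by ring))
    intro x hx
    obtain ⟨hd1, hd2, e1, e2⟩ := differentiableAt_and_deriv_of_hasDerivAt_Ioi hu
      (fun x hx => (h x hx).1) (fun x hx => (h x hx).2.1) hx
    refine ⟨hd1, hd2, ?_⟩
    have hode := (h x hx).2.2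
    rw [sub_zero, hK, ← hu x hx, ← e1, ← e2] at hode
    rw [← hode]
    push_cast
    ring
  · obtain ⟨D₁, D₂, h⟩ := exists_hasDerivAt_mul_hyp2F1C hxstar (α := (lam / r : ℝ))
      (β := (lam / r : ℝ) + a1) (μ := (lam / r : ℝ)) hc2 (by ring) (by ring)
      (fun x hx => ((hW x hx).mul (hP x hx)).congr_deriv (by simp only [Pi.mul_apply]; ring))
    intro x hx
    obtain ⟨hd1, hd2, e1, e2⟩ := differentiableAt_and_deriv_of_hasDerivAt_Ioi hv
      (fun x hx => (h x hx).1) (fun x hx => (h x hx).2.1) hx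
    refine ⟨hd1, hd2, ?_⟩
    have hode := (h x hx).2.2
    simp only [Pi.mul_apply] at hode
    rw [add_sub_cancel_left, hK, ← hv x hx, ← e1, ← e2] at hode
    rw [← hode]
    push_cast
    ring
end
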